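/- arXiv:0709.2935 — 3 statements merged into one kernel-verified Lean document; each statement's English description precedes it below -/
import Mathlib

section
/- Let n ∈ ℕ, a₀,…,aₙ ∈ ℝ, λ ∈ ℝ, m ∈ ℕ and α₀,…,α_m ∈ ℝ, and let x(t) = Σ_{l=0}^m α_l tˡ e^{λt}. Then for all t ∈ ℝ, Σ_{k=0}^n aₖ x^{(k)}(t) = Σ_{k=0}^m ( Σ_{l=k}^m binom(l,k) · p^{(l−k)}(λ) · α_l ) tᵏ e^{λt}, where p(s) = Σ_{k=0}^n aₖ sᵏ and p^{(i)} denotes its i-th derivative. That is, L acts on 𝔈𝔓^m_λ by the upper-triangular matrix (a_{kl}) with a_{kl} = binom(l,k)·p^{(l−k)}(λ) for k ≤ l and a_{kl} = 0 for k > l. -/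
theorem L_aux (k l : ℕ) (lam t : ℝ) :
    iteratedDeriv k (fun t : ℝ => t ^ l * Real.exp (lam * t)) t =
      ∑ j ∈ Finset.range (l + 1), (l.choose j : ℝ) *
        (Polynomial.derivative^[l - j] (Polynomial.X ^ k : Polynomial ℝ)).eval lam *
        t ^ j * Real.exp (lam * t) := by
  rw [iteratedDeriv_fun_mul (by fun_prop) (by fun_prop)]
  rw [← Finset.sum_range_reflect]
  simp only [iteratedDeriv_pow, iteratedDeriv_exp_const_mul]
  have e1 : ∑ j ∈ Finset.range (k + 1), (k.choose (k + 1 - 1 - j) : ℝ) *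
      ((l.descFactorial (k + 1 - 1 - j) : ℝ) * t ^ (l - (k + 1 - 1 - j))) *
        (lam ^ (k - (k + 1 - 1 - j)) * Real.exp (lam * t)) =
      ∑ i ∈ Finset.range (k + 1), (k.choose i : ℝ) *
      ((l.descFactorial i : ℝ) * t ^ (l - i)) * (lam ^ (k - i) * Real.exp (lam * t)) :=
    Finset.sum_range_reflect (fun i => (k.choose i : ℝ) *
      ((l.descFactorial i : ℝ) * t ^ (l - i)) * (lam ^ (k - i) * Real.exp (lam * t))) (k + 1)
  rw [e1, ← Finset.sum_range_reflect _ (l + 1)]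
  have e2 : ∀ i ∈ Finset.range (l + 1), (l.choose (l + 1 - 1 - i) : ℝ) *
        (Polynomial.derivative^[l - (l + 1 - 1 - i)] (Polynomial.X ^ k : Polynomial ℝ)).eval lam *
        t ^ (l + 1 - 1 - i) * Real.exp (lam * t) =
      (k.choose i : ℝ) *
      ((l.descFactorial i : ℝ) * t ^ (l - i)) * (lam ^ (k - i) * Real.exp (lam * t)) := by
    intro i hi
    have hi' : i ≤ l := by simpa [Nat.lt_succ_iff] using hi
    rw [Nat.add_sub_cancel, Nat.sub_sub_self hi', Nat.choose_symm hi',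
      Polynomial.iterate_derivative_X_pow_eq_C_mul, Nat.descFactorial_eq_factorial_mul_choose,
      Nat.descFactorial_eq_factorial_mul_choose]
    simp only [Polynomial.eval_mul, Polynomial.eval_C, Polynomial.eval_pow, Polynomial.eval_X]
    push_cast
    ring
  rw [Finset.sum_congr rfl e2]
  have s1 : Finset.range (k + 1) ⊆ Finset.range (k + l + 1) :=
    Finset.range_subset_range.2 (by omega)
  have s2 : Finset.range (l + 1) ⊆ Finset.range (k + l + 1) :=
    Finset.range_subset_range.2 (by omega)
  rw [Finset.sum_subset s1, Finset.sum_subset s2]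
  · intro i _ h
    rw [Nat.descFactorial_of_lt (by simpa using h)]
    simp
  · intro i _ h
    rw [Nat.choose_eq_zero_of_lt (by simpa using h)]
    simp

/-- `L` acts on 𝔈𝔓^m_λ by the upper-triangular matrix `(a_{kl})` with
`a_{kl} = binom(l,k) p^{(l−k)}(λ)` for `k ≤ l` and `a_{kl} = 0` for `k > l`:
if `x(t) = Σ_{l=0}^m α_l tˡ e^{λt}`, then
`L(x)(t) = Σ_{k=0}^m (Σ_{l=k}^m binom(l,k) p^{(l−k)}(λ) α_l) tᵏ e^{λt}`. -/
theorem L_poly_exp (n : ℕ) (a : ℕ → ℝ) (lam : ℝ) (m : ℕ) (α : ℕ → ℝ)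
    (p : Polynomial ℝ)
    (hp : p = ∑ i ∈ Finset.range (n + 1), Polynomial.C (a i) * Polynomial.X ^ i)
    (x : ℝ → ℝ)
    (hx : ∀ t : ℝ, x t = ∑ l ∈ Finset.range (m + 1), α l * t ^ l * Real.exp (lam * t)) :
    ∀ t : ℝ, ∑ k ∈ Finset.range (n + 1), a k * iteratedDeriv k x t =
      ∑ k ∈ Finset.range (m + 1),
        (∑ l ∈ Finset.Icc k m,
          (l.choose k : ℝ) * (Polynomial.derivative^[l - k] p).eval lam * α l) *
        t ^ k * Real.exp (lam * t) := by
  intro t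
  have hD : ∀ k, iteratedDeriv k x t = ∑ l ∈ Finset.range (m + 1), α l *
      ∑ j ∈ Finset.range (l + 1), (l.choose j : ℝ) *
        (Polynomial.derivative^[l - j] (Polynomial.X ^ k : Polynomial ℝ)).eval lam *
        t ^ j * Real.exp (lam * t) := by
    intro k
    have : x = fun t => ∑ l ∈ Finset.range (m + 1), α l * (t ^ l * Real.exp (lam * t)) := by
      funext t
      simp only [hx, mul_assoc]
    rw [this, iteratedDeriv_fun_sum (fun i _ => by fun_prop)]
    refine Finset.sum_congr rfl fun l _ => ?_
    rw [iteratedDeriv_const_mul_field, L_aux]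
  have hP : ∀ i, (Polynomial.derivative^[i] p).eval lam = ∑ k ∈ Finset.range (n + 1),
      a k * (Polynomial.derivative^[i] (Polynomial.X ^ k : Polynomial ℝ)).eval lam := by
    intro i
    rw [hp, Polynomial.iterate_derivative_sum, Polynomial.eval_finset_sum]
    simp [Polynomial.iterate_derivative_C_mul]
  have hR : ∑ k ∈ Finset.range (n + 1), a k * iteratedDeriv k x t =
      ∑ l ∈ Finset.range (m + 1), ∑ j ∈ Finset.range (l + 1),
        (l.choose j : ℝ) * (Polynomial.derivative^[l - j] p).eval lam * α l *
        t ^ j * Real.exp (lam * t) := by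
    simp only [hD, hP, Finset.mul_sum, Finset.sum_mul]
    rw [Finset.sum_comm]
    refine Finset.sum_congr rfl fun l _ => ?_
    rw [Finset.sum_comm]
    refine Finset.sum_congr rfl fun j _ => Finset.sum_congr rfl fun k _ => ?_
    ring
  rw [hR]
  simp only [Finset.sum_mul]
  apply Finset.sum_comm'
  intro l j
  simp only [Finset.mem_range, Finset.mem_Icc]
  omega
end

section
/- Let n ∈ ℕ, a₀,…,aₙ ∈ ℝ, ω ∈ ℝ, m ∈ ℕ and γ₀,…,γ_m ∈ ℂ, and let x(t) = Σ_{l=0}^m tˡ · Re(γ_l · e^{iωt}). Then for all t ∈ ℝ, Σ_{k=0}^n aₖ x^{(k)}(t) = Σ_{k=0}^m tᵏ · Re( ( Σ_{l=k}^m binom(l,k) · p^{(l−k)}(iω) · γ_l ) · e^{iωt} ), where p(s) = Σ_{k=0}^n aₖ sᵏ and p^{(i)} denotes its i-th derivative (evaluated at the complex argument iω). -/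
open Polynomial in
/-- the image of `tˡ e^{zt}` under `q(d/dt)` -/
noncomputable def phS (z : ℂ) (l : ℕ) (q : ℝ[X]) (t : ℝ) : ℂ :=
  (∑ k ∈ Finset.range (l + 1), (l.choose k : ℂ) * (t : ℂ) ^ k *
    aeval z (derivative^[l - k] q)) * Complex.exp (z * t)

open Polynomial in
theorem phS_key (z : ℂ) (l : ℕ) (q : ℝ[X]) (t : ℝ) :
    (∑ k ∈ Finset.range (l + 1), (l.choose k : ℂ) * (k * (t : ℂ) ^ (k - 1)) *
      aeval z (derivative^[l - k] q)) +
    (∑ k ∈ Finset.range (l + 1), (l.choose k : ℂ) * (t : ℂ) ^ k *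
      aeval z (derivative^[l - k] q)) * z =
    ∑ k ∈ Finset.range (l + 1), (l.choose k : ℂ) * (t : ℂ) ^ k *
      aeval z (derivative^[l - k] (X * q)) := by
  have h : ∀ k, aeval z (derivative^[l - k] (X * q)) =
      z * aeval z (derivative^[l - k] q) +
        ((l - k : ℕ) : ℂ) * aeval z (derivative^[l - k - 1] q) := by
    intro k
    rw [mul_comm X q, iterate_derivative_mul_X]
    simp [mul_comm]
  simp only [h, mul_add, Finset.sum_add_distrib, Finset.sum_mul]
  rw [add_comm]
  congr 1
  · exact Finset.sum_congr rfl fun k _ => by ring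
  · rw [Finset.sum_range_succ', Finset.sum_range_succ]
    simp only [Nat.cast_zero, zero_mul, mul_zero, add_zero, Nat.sub_self]
    refine Finset.sum_congr rfl fun k hk => ?_
    have hc : (l.choose (k + 1) : ℂ) * ((k + 1 : ℕ) : ℂ) = l.choose k * ((l - k : ℕ) : ℂ) := by
      exact_mod_cast Nat.choose_succ_right_eq l k
    rw [show l - (k + 1) = l - k - 1 by omega, Nat.add_sub_cancel]
    linear_combination (t : ℂ) ^ k * aeval z (derivative^[l - k - 1] q) * hc

open Polynomial in
theorem phS_deriv (z : ℂ) (l : ℕ) (q : ℝ[X]) (t : ℝ) :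
    HasDerivAt (phS z l q) (phS z l (X * q) t) t := by
  have h1 : HasDerivAt (fun s : ℂ => (∑ k ∈ Finset.range (l + 1), (l.choose k : ℂ) * s ^ k *
      aeval z (derivative^[l - k] q)) * Complex.exp (z * s)) (phS z l (X * q) t) (t : ℂ) := by
    have h2 : HasDerivAt (fun s : ℂ => ∑ k ∈ Finset.range (l + 1), (l.choose k : ℂ) * s ^ k *
      aeval z (derivative^[l - k] q)) (∑ k ∈ Finset.range (l + 1),
        (l.choose k : ℂ) * (k * (t : ℂ) ^ (k - 1)) * aeval z (derivative^[l - k] q)) (t : ℂ) :=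
      HasDerivAt.fun_sum fun k _ => ((hasDerivAt_pow k (t : ℂ)).const_mul _).mul_const _
    have h3 : HasDerivAt (fun s : ℂ => Complex.exp (z * s)) (Complex.exp (z * t) * (z * 1)) t :=
      ((hasDerivAt_id (t : ℂ)).const_mul z).cexp
    refine (h2.mul h3).congr_deriv ?_
    rw [phS, ← phS_key]
    ring
  exact h1.comp_ofReal

open Polynomial in
theorem phS_iter (z : ℂ) (m : ℕ) (γ : ℕ → ℂ) (j : ℕ) :
    iteratedDeriv j (fun t : ℝ => (∑ l ∈ Finset.range (m + 1), γ l * phS z l 1 t).re) =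
      fun t : ℝ => (∑ l ∈ Finset.range (m + 1), γ l * phS z l (X ^ j) t).re := by
  induction j with
  | zero => simp
  | succ j ih =>
    rw [iteratedDeriv_succ, ih]
    funext t
    have h : HasDerivAt (fun t : ℝ => ∑ l ∈ Finset.range (m + 1), γ l * phS z l (X ^ j) t)
        (∑ l ∈ Finset.range (m + 1), γ l * phS z l (X * X ^ j) t) t :=
      HasDerivAt.fun_sum fun l _ => (phS_deriv z l (X ^ j) t).const_mul _
    have h2 := (Complex.reCLM.hasFDerivAt.comp_hasDerivAt t h).deriv
    rw [pow_succ']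
    exact h2

open Polynomial in
theorem phS_one (z : ℂ) (l : ℕ) (t : ℝ) :
    phS z l 1 t = (t : ℂ) ^ l * Complex.exp (z * t) := by
  rw [phS, Finset.sum_range_succ, Finset.sum_eq_zero]
  · simp
  · intro k hk
    rw [Finset.mem_range] at hk
    rw [iterate_derivative_one (by omega)]
    simp

open Polynomial in
theorem phS_lin (z : ℂ) (l n : ℕ) (a : ℕ → ℝ) (t : ℝ) :
    phS z l (∑ i ∈ Finset.range (n + 1), C (a i) * X ^ i) t =
      ∑ i ∈ Finset.range (n + 1), (a i : ℂ) * phS z l (X ^ i) t := by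
  simp only [phS, iterate_derivative_sum, iterate_derivative_C_mul, map_sum, map_mul, aeval_C,
    Complex.coe_algebraMap, Finset.mul_sum, Finset.sum_mul]
  rw [Finset.sum_comm]
  exact Finset.sum_congr rfl fun i _ => Finset.sum_congr rfl fun k _ => by ring

/-- `L` acts on 𝔠𝔓^m_ω by the upper-triangular complex matrix
`(binom(l,k) p^{(l−k)}(iω))`: if `x(t) = Σ_{l=0}^m tˡ Re(γ_l e^{iωt})`, then
`L(x)(t) = Σ_{k=0}^m tᵏ Re((Σ_{l=k}^m binom(l,k) p^{(l−k)}(iω) γ_l) e^{iωt})`. -/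
theorem L_poly_phasor (n : ℕ) (a : ℕ → ℝ) (ω : ℝ) (m : ℕ) (γ : ℕ → ℂ)
    (p : Polynomial ℝ)
    (hp : p = ∑ i ∈ Finset.range (n + 1), Polynomial.C (a i) * Polynomial.X ^ i)
    (x : ℝ → ℝ)
    (hx : ∀ t : ℝ, x t =
      ∑ l ∈ Finset.range (m + 1), t ^ l * (γ l * Complex.exp (Complex.I * ω * t)).re) :
    ∀ t : ℝ, ∑ k ∈ Finset.range (n + 1), a k * iteratedDeriv k x t =
      ∑ k ∈ Finset.range (m + 1),
        t ^ k * ((∑ l ∈ Finset.Icc k m,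
            (l.choose k : ℂ) *
              Polynomial.aeval (Complex.I * ω) (Polynomial.derivative^[l - k] p) * γ l) *
          Complex.exp (Complex.I * ω * t)).re := by
  intro t
  have hx' : x = fun t : ℝ =>
      (∑ l ∈ Finset.range (m + 1), γ l * phS (Complex.I * ω) l 1 t).re := by
    funext s
    rw [hx, Complex.re_sum]
    refine Finset.sum_congr rfl fun l _ => ?_
    rw [phS_one, ← Complex.re_ofReal_mul]
    congr 1
    push_cast
    ring
  rw [hx']
  simp only [phS_iter, ← Complex.re_ofReal_mul]
  rw [← Complex.re_sum]
  rw [← Complex.re_sum]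
  congr 1
  have h1 : ∑ k ∈ Finset.range (n + 1), (a k : ℂ) *
      ∑ l ∈ Finset.range (m + 1), γ l * phS (Complex.I * ω) l (Polynomial.X ^ k) t =
      ∑ l ∈ Finset.range (m + 1), γ l * phS (Complex.I * ω) l p t := by
    simp only [hp, phS_lin, Finset.mul_sum]
    rw [Finset.sum_comm]
    exact Finset.sum_congr rfl fun i _ => Finset.sum_congr rfl fun k _ => by ring
  rw [h1]
  simp only [phS, Finset.mul_sum, Finset.sum_mul, Complex.ofReal_pow]
  rw [Finset.sum_comm' (t' := Finset.range (m + 1)) (s' := fun k => Finset.Icc k m)]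
  · exact Finset.sum_congr rfl fun i _ => Finset.sum_congr rfl fun k _ => by ring
  · intro l k
    simp only [Finset.mem_range, Finset.mem_Icc]
    omega
end

section
/- (Theorem CP: particular solution for input in 𝔠𝔓^m_ω.) Let n ∈ ℕ, a₀,…,aₙ ∈ ℝ, ω ∈ ℝ, m ∈ ℕ and γ₀,…,γ_m ∈ ℂ, and suppose p(iω) ≠ 0 where p(s) = Σ_{k=0}^n aₖ sᵏ. Let x₀,…,x_m ∈ ℂ be any complex numbers satisfying the triangular system p(iω)·xₖ + Σ_{l=k+1}^m binom(l,k)·p^{(l−k)}(iω)·x_l = γₖ for all 0 ≤ k ≤ m (these xₖ exist uniquely, given by x_m = γ_m/p(iω) and, successively for l = 1,…,m, x_{m−l} = (1/p(iω))·(γ_{m−l} − Σ_{k=m−l+1}^m binom(k, m−l)·p^{(k−m+l)}(iω)·xₖ)). Then the function x(t) = Σ_{k=0}^m tᵏ · Re(xₖ · e^{iωt}) satisfies Σ_{k=0}^n aₖ x^{(k)}(t) = Σ_{k=0}^m tᵏ · Re(γₖ · e^{iωt}) for all t ∈ ℝ. -/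
open Polynomial in
/-- The operator `D + μ` on polynomials. -/
noncomputable def shiftOp (μ : ℂ) : Module.End ℂ ℂ[X] :=
  (Polynomial.derivative : ℂ[X] →ₗ[ℂ] ℂ[X]) + μ • (1 : Module.End ℂ ℂ[X])

open Polynomial in
lemma hasDerivAt_quasi (μ : ℂ) (q : ℂ[X]) (s : ℝ) :
    HasDerivAt (fun s : ℝ => (q.eval (s : ℂ) * Complex.exp (μ * s)).re)
      (((shiftOp μ q).eval (s : ℂ) * Complex.exp (μ * s)).re) s := by
  have h1 : HasDerivAt (fun z : ℂ => q.eval z * Complex.exp (μ * z))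
      ((shiftOp μ q).eval (s : ℂ) * Complex.exp (μ * s)) (s : ℂ) := by
    have h2 : HasDerivAt (fun z : ℂ => Complex.exp (μ * z))
        (Complex.exp (μ * s) * (μ * 1)) (s : ℂ) :=
      ((hasDerivAt_id (s : ℂ)).const_mul μ).cexp
    refine ((q.hasDerivAt (s : ℂ)).mul h2).congr_deriv ?_
    simp [shiftOp]
    ring
  exact h1.real_of_complex

open Polynomial in
lemma iteratedDeriv_quasi (μ : ℂ) (q : ℂ[X]) (k : ℕ) :
    iteratedDeriv k (fun s : ℝ => (q.eval (s : ℂ) * Complex.exp (μ * s)).re) =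
      fun s : ℝ => ((((shiftOp μ) ^ k) q).eval (s : ℂ) * Complex.exp (μ * s)).re := by
  induction k with
  | zero => simp
  | succ k ih =>
    rw [iteratedDeriv_succ, ih]
    funext s
    rw [(hasDerivAt_quasi μ _ s).deriv, pow_succ', Module.End.mul_apply]

open Polynomial in
lemma shiftOp_pow_X (μ : ℂ) (k l : ℕ) (t : ℂ) :
    (((shiftOp μ) ^ k) (X ^ l)).eval t =
      ∑ i ∈ Finset.range (l + 1), (l.choose i : ℂ) *
        (derivative^[i] (X ^ k : ℂ[X])).eval μ * t ^ (l - i) := by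
  have hc : Commute (Polynomial.derivative : ℂ[X] →ₗ[ℂ] ℂ[X])
      (μ • (1 : Module.End ℂ ℂ[X])) := (Commute.one_right _).smul_right μ
  have h1 : (((shiftOp μ) ^ k) (X ^ l)).eval t =
      ∑ i ∈ Finset.range (k + 1), (k.choose i : ℂ) * (l.descFactorial i : ℂ) *
        μ ^ (k - i) * t ^ (l - i) := by
    rw [shiftOp, hc.add_pow, LinearMap.sum_apply, eval_finsetSum]
    refine Finset.sum_congr rfl fun i _ => ?_
    rw [_root_.smul_pow, one_pow, ← nsmul_eq_mul', LinearMap.smul_apply, Module.End.mul_apply,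
      LinearMap.smul_apply, Module.End.one_apply, map_smul, Module.End.pow_apply,
      iterate_derivative_X_pow_eq_natCast_mul]
    simp
    ring
  have h2 : ∀ i, (k.choose i : ℂ) * (l.descFactorial i : ℂ) =
      (l.choose i : ℂ) * (k.descFactorial i : ℂ) := by
    intro i
    rw [Nat.descFactorial_eq_factorial_mul_choose, Nat.descFactorial_eq_factorial_mul_choose]
    push_cast
    ring
  have h3 : ∀ N : ℕ, k ≤ N → ∑ i ∈ Finset.range (k + 1),
      (k.choose i : ℂ) * (l.descFactorial i : ℂ) * μ ^ (k - i) * t ^ (l - i) =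
      ∑ i ∈ Finset.range (N + 1),
      (k.choose i : ℂ) * (l.descFactorial i : ℂ) * μ ^ (k - i) * t ^ (l - i) := by
    intro N hN
    refine Finset.sum_subset (Finset.range_mono (by omega)) fun i _ hi => ?_
    rw [Nat.choose_eq_zero_of_lt (by simpa using hi)]
    simp
  rw [h1, h3 (k + l) (by omega)]
  symm
  rw [Finset.sum_subset (Finset.range_mono (show l + 1 ≤ k + l + 1 by omega))]
  · refine Finset.sum_congr rfl fun i _ => ?_
    rw [h2, iterate_derivative_X_pow_eq_natCast_mul, eval_mul, eval_natCast, eval_pow, eval_X]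
    ring
  · intro i _ hi
    rw [Nat.choose_eq_zero_of_lt (by simpa using hi)]
    simp

/-- Theorem CP: particular solution for input in 𝔠𝔓^m_ω. If `p(iω) ≠ 0` and the
complex coefficients `x₀,…,x_m` solve the triangular system
`p(iω)xₖ + Σ_{l=k+1}^m binom(l,k) p^{(l−k)}(iω) x_l = γₖ` for all `0 ≤ k ≤ m`,
then `x(t) = Σ_{k=0}^m tᵏ Re(xₖ e^{iωt})` satisfies
`L(x)(t) = Σ_{k=0}^m tᵏ Re(γₖ e^{iωt})`. -/
theorem CP_particular_solution (n : ℕ) (a : ℕ → ℝ) (ω : ℝ) (m : ℕ)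
    (γ x : ℕ → ℂ) (p : Polynomial ℝ)
    (hp : p = ∑ i ∈ Finset.range (n + 1), Polynomial.C (a i) * Polynomial.X ^ i)
    (hpiω : Polynomial.aeval (Complex.I * (ω : ℂ)) p ≠ 0)
    (hsys : ∀ k ≤ m,
      Polynomial.aeval (Complex.I * (ω : ℂ)) p * x k +
        ∑ l ∈ Finset.Icc (k + 1) m,
          (l.choose k : ℂ) *
            Polynomial.aeval (Complex.I * (ω : ℂ)) (Polynomial.derivative^[l - k] p) * x l
        = γ k) :
    ∀ t : ℝ, ∑ k ∈ Finset.range (n + 1),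
        a k * iteratedDeriv k
          (fun s : ℝ => ∑ j ∈ Finset.range (m + 1),
            s ^ j * (x j * Complex.exp (Complex.I * ω * s)).re) t =
      ∑ k ∈ Finset.range (m + 1), t ^ k * (γ k * Complex.exp (Complex.I * ω * t)).re := by
  intro t
  set μ : ℂ := Complex.I * (ω : ℂ) with hμ
  set q : Polynomial ℂ := ∑ j ∈ Finset.range (m + 1), x j • Polynomial.X ^ j with hq
  have hf : (fun s : ℝ => ∑ j ∈ Finset.range (m + 1),
      s ^ j * (x j * Complex.exp (μ * s)).re) =
      fun s : ℝ => (q.eval (s : ℂ) * Complex.exp (μ * s)).re := by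
    funext s
    rw [hq, Polynomial.eval_finsetSum, Finset.sum_mul, Complex.re_sum]
    refine Finset.sum_congr rfl fun j _ => ?_
    rw [← Complex.re_ofReal_mul]
    congr 1
    simp
    ring
  rw [hf]
  simp only [iteratedDeriv_quasi]
  have hder : ∀ i : ℕ, Polynomial.aeval μ (Polynomial.derivative^[i] p) =
      ∑ k ∈ Finset.range (n + 1), (a k : ℂ) *
        (Polynomial.derivative^[i] (Polynomial.X ^ k : Polynomial ℂ)).eval μ := by
    intro i
    rw [hp, Polynomial.iterate_derivative_sum, map_sum]
    refine Finset.sum_congr rfl fun k _ => ?_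
    rw [Polynomial.iterate_derivative_C_mul,
      Polynomial.iterate_derivative_X_pow_eq_natCast_mul,
      Polynomial.iterate_derivative_X_pow_eq_natCast_mul]
    simp
  have hL : ∑ k ∈ Finset.range (n + 1), (a k : ℂ) * (((shiftOp μ) ^ k) q).eval (t : ℂ) =
      ∑ k ∈ Finset.range (m + 1), (t : ℂ) ^ k * γ k := by
    have h1 : ∀ l, ∑ k ∈ Finset.range (n + 1),
        (a k : ℂ) * (((shiftOp μ) ^ k) (Polynomial.X ^ l)).eval (t : ℂ) =
        ∑ j ∈ Finset.range (l + 1), (l.choose j : ℂ) *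
          Polynomial.aeval μ (Polynomial.derivative^[l - j] p) * (t : ℂ) ^ j := by
      intro l
      rw [← Finset.sum_range_reflect (fun j => (l.choose j : ℂ) *
          Polynomial.aeval μ (Polynomial.derivative^[l - j] p) * (t : ℂ) ^ j)]
      simp only [shiftOp_pow_X, hder, Finset.mul_sum, Finset.sum_mul]
      rw [Finset.sum_comm]
      refine Finset.sum_congr rfl fun i hi => Finset.sum_congr rfl fun k _ => ?_
      have hi' : i ≤ l := by simpa [Nat.lt_succ_iff] using hi
      rw [show l + 1 - 1 - i = l - i by omega, show l - (l - i) = i by omega,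
        Nat.choose_symm hi']
      ring
    have h2 : ∑ k ∈ Finset.range (n + 1), (a k : ℂ) * (((shiftOp μ) ^ k) q).eval (t : ℂ) =
        ∑ l ∈ Finset.range (m + 1), x l * ∑ j ∈ Finset.range (l + 1), (l.choose j : ℂ) *
          Polynomial.aeval μ (Polynomial.derivative^[l - j] p) * (t : ℂ) ^ j := by
      simp only [← h1, hq, map_sum, map_smul, Polynomial.eval_finsetSum, Polynomial.eval_smul,
        Finset.mul_sum, smul_eq_mul]
      rw [Finset.sum_comm]
      refine Finset.sum_congr rfl fun i hi => Finset.sum_congr rfl fun k _ => ?_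
      ring
    rw [h2]
    simp only [Finset.mul_sum]
    rw [Finset.sum_comm' (t' := Finset.range (m + 1)) (s' := fun j => Finset.Icc j m)
      (by intro l j; simp only [Finset.mem_range, Finset.mem_Icc]; omega)]
    refine Finset.sum_congr rfl fun k hk => ?_
    have hk' : k ≤ m := by simpa [Nat.lt_succ_iff] using hk
    rw [← hsys k hk', ← Finset.add_sum_Ioc_eq_sum_Icc hk', mul_add, Finset.mul_sum]
    congr 1
    · simp
      ring
    · refine Finset.sum_congr (by ext; simp [Nat.succ_le_iff]) fun l _ => ?_
      ring
  have h3 : ∀ k, a k * ((((shiftOp μ) ^ k) q).eval (t : ℂ) * Complex.exp (μ * t)).re =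
      ((a k : ℂ) * (((shiftOp μ) ^ k) q).eval (t : ℂ) * Complex.exp (μ * t)).re := by
    intro k
    rw [mul_assoc (a k : ℂ), Complex.re_ofReal_mul]
  simp only [h3]
  rw [← Complex.re_sum, ← Finset.sum_mul, hL, Finset.sum_mul, Complex.re_sum]
  refine Finset.sum_congr rfl fun k _ => ?_
  rw [← Complex.re_ofReal_mul]
  congr 1
  push_cast
  ring
end
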